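/- arXiv:2501.06204 — 7 statements merged into one kernel-verified Lean document; each statement's English description precedes it below -/
import Mathlib

section
/- Let q and α be real numbers with 0 < q < 1 and α > 0. Then for every x ∈ ℝ, |h_{q,α}(x)| < max(1/(1+q), q/(1−q)). In particular h_{q,α} is a bounded function on ℝ. -/
/-- The generalized hyperbolic tangent activation function. -/
noncomputable def h (q α x : ℝ) : ℝ :=
  (Real.exp (α * x) - q * Real.exp (-(α * x))) /
    ((1 + q) * Real.exp (α * x) + (1 - q) * Real.exp (-(α * x)))

theorem h_abs_lt (q α : ℝ) (hq0 : 0 < q) (hq1 : q < 1) (hα : 0 < α) :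
    ∀ x : ℝ, |h q α x| < max (1 / (1 + q)) (q / (1 - q)) := by
  intro x
  have ha := Real.exp_pos (α * x)
  have hb := Real.exp_pos (-(α * x))
  unfold h
  generalize Real.exp (α * x) = a at *
  generalize Real.exp (-(α * x)) = b at *
  have hq : 0 < 1 - q := sub_pos.2 hq1
  have hD : 0 < (1 + q) * a + (1 - q) * b := by positivity
  have upper : (a - q * b) / ((1 + q) * a + (1 - q) * b) < 1 / (1 + q) := by
    rw [div_lt_div_iff₀ hD (by positivity)]
    have : 0 < (1 + q ^ 2) * b := by positivity
    linarith
  have lower : -((a - q * b) / ((1 + q) * a + (1 - q) * b)) < q / (1 - q) := by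
    rw [← neg_div, div_lt_div_iff₀ hD hq]
    have : 0 < (1 + q ^ 2) * a := by positivity
    linarith
  exact max_lt (lt_max_of_lt_left upper) (lt_max_of_lt_right lower)
end

section
/- Let q and α be real numbers with 0 < q < 1 and α > 0. Then the range of h_{q,α} is exactly the open interval (−q/(1−q), 1/(1+q)), i.e., Set.range h_{q,α} = Ioo (−q/(1−q)) (1/(1+q)). -/
theorem h_range (q α : ℝ) (hq0 : 0 < q) (hq1 : q < 1) (hα : 0 < α) :
    Set.range (h q α) = Set.Ioo (-q / (1 - q)) (1 / (1 + q)) := by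
  have hm : 0 < 1 - q := by linarith
  have hp : 0 < 1 + q := by linarith
  have hden (x : ℝ) :
      0 < (1 + q) * Real.exp (α * x) + (1 - q) * Real.exp (-(α * x)) := by positivity
  ext y
  constructor
  · rintro ⟨x, rfl⟩
    have hE := Real.exp_pos (α * x)
    have hF := Real.exp_pos (-(α * x))
    have hd := hden x
    unfold h
    constructor
    · rw [div_lt_div_iff₀ hm hd]
      nlinarith [mul_pos (show 0 < 1 + q ^ 2 by positivity) hE]
    · rw [div_lt_div_iff₀ hd hp]
      nlinarith [mul_pos (show 0 < 1 + q ^ 2 by positivity) hF]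
  · rintro ⟨hy1, hy2⟩
    rw [div_lt_iff₀ hm] at hy1
    rw [lt_div_iff₀ hp] at hy2
    have hn : 0 < q + y * (1 - q) := by linarith
    have hd : 0 < 1 - y * (1 + q) := by linarith
    set t := (q + y * (1 - q)) / (1 - y * (1 + q))
    have htd : t * (1 - y * (1 + q)) = q + y * (1 - q) := div_mul_cancel₀ _ hd.ne'
    have hE : Real.exp (α * (Real.log t / (2 * α))) =
        t * Real.exp (-(α * (Real.log t / (2 * α)))) := by
      have hx : α * (Real.log t / (2 * α)) =
          Real.log t + -(α * (Real.log t / (2 * α))) := by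
        field_simp
        ring
      conv_lhs => rw [hx, Real.exp_add, Real.exp_log (div_pos hn hd)]
    refine ⟨Real.log t / (2 * α), ?_⟩
    rw [h, div_eq_iff (hden _).ne', hE]
    linear_combination Real.exp (-(α * (Real.log t / (2 * α)))) * htd
end

section
/- Let q and α be real numbers with 0 < q < 1 and α > 0. Then ψ_{q,α}(x) > 0 for every x ∈ ℝ. -/
/-- The associated density function. -/
noncomputable def ψ (q α x : ℝ) : ℝ :=
  ((1 - q ^ 2) / (2 * (1 + q ^ 2))) * (h q α (x + 1) - h q α (x - 1))

/-- The activation function is strictly increasing: `h q α` is a Möbius transformation with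
determinant `1 + q ^ 2` of the increasing function `x ↦ exp (2 * α * x)`. -/
theorem h_strictMono {q α : ℝ} (hq0 : 0 < q) (hq1 : q < 1) (hα : 0 < α) :
    StrictMono (h q α) := by
  intro x y hxy
  have hq : 0 < 1 - q := sub_pos.2 hq1
  have hcross : Real.exp (α * x) * Real.exp (-(α * y)) <
      Real.exp (α * y) * Real.exp (-(α * x)) := by
    rw [← Real.exp_add, ← Real.exp_add, Real.exp_lt_exp]
    linarith [mul_lt_mul_of_pos_left hxy hα]
  unfold h
  rw [div_lt_div_iff₀ (by positivity) (by positivity)]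
  linarith [mul_lt_mul_of_pos_left hcross (show 0 < 1 + q ^ 2 by positivity)]

theorem psi_pos (q α : ℝ) (hq0 : 0 < q) (hq1 : q < 1) (hα : 0 < α) :
    ∀ x : ℝ, 0 < ψ q α x := by
  intro x
  have hq : 0 < 1 - q ^ 2 := by nlinarith
  have hdiff : 0 < h q α (x + 1) - h q α (x - 1) :=
    sub_pos.2 (h_strictMono hq0 hq1 hα (by linarith))
  unfold ψ
  positivity
end

section
/- Let q and α be real numbers with 0 < q < 1 and α > 0. Then for every x ∈ ℝ the family (ψ_{q,α}(x − k))_{k ∈ ℤ} is summable and Σ_{k ∈ ℤ} ψ_{q,α}(x − k) = 1 (the partition-of-unity / discrete normalization property of the density function). -/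
open Filter Topology

theorem Monotone.hasSum_int_sub_of_tendsto {u : ℤ → ℝ} (hu : Monotone u) {a b : ℝ}
    (htop : Tendsto u atTop (𝓝 a)) (hbot : Tendsto u atBot (𝓝 b)) :
    HasSum (fun k : ℤ => u (k + 1) - u k) (a - b) := by
  have hpos : HasSum (fun n : ℕ => u (n + 1) - u n) (a - u 0) := by
    rw [hasSum_iff_tendsto_nat_of_nonneg fun n => sub_nonneg.2 (hu (by lia))]
    have key (N : ℕ) : ∑ n ∈ Finset.range N, (u (n + 1) - u n) = u N - u 0 := by
      simpa using Finset.sum_range_sub (fun n : ℕ => u n) N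
    simp_rw [key]
    exact (htop.comp tendsto_natCast_atTop_atTop).sub_const _
  have hneg : HasSum (fun n : ℕ => u (-(n + 1 : ℤ) + 1) - u (-(n + 1 : ℤ))) (u 0 - b) := by
    rw [hasSum_iff_tendsto_nat_of_nonneg fun n => sub_nonneg.2 (hu (by lia))]
    have key (N : ℕ) : ∑ n ∈ Finset.range N, (u (-(n + 1 : ℤ) + 1) - u (-(n + 1 : ℤ))) =
        u 0 - u (-N) := by
      simpa using Finset.sum_range_sub' (fun n : ℕ => u (-n)) N
    simp_rw [key]
    exact (hbot.comp (tendsto_neg_atTop_atBot.comp tendsto_natCast_atTop_atTop)).const_sub _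
  simpa using hpos.of_nat_of_neg_add_one (f := fun k : ℤ => u (k + 1) - u k) hneg

theorem h_eq_sub_div {q : ℝ} (hq0 : 0 < q) (hq1 : q < 1) (α x : ℝ) :
    h q α x = 1 / (1 + q) -
      (1 + q ^ 2) / (1 + q) / ((1 + q) * Real.exp (2 * α * x) + (1 - q)) := by
  have hE := Real.exp_pos (α * x)
  have hsq : Real.exp (2 * α * x) = Real.exp (α * x) ^ 2 := by
    rw [← Real.exp_nat_mul]; ring_nf
  have hq : 0 < 1 - q := by linarith
  rw [h, hsq, Real.exp_neg]
  generalize Real.exp (α * x) = E at hE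
  have h₁ : (1 + q) * E ^ 2 + (1 - q) ≠ 0 := by positivity
  have h₂ : (1 + q) * E + (1 - q) * E⁻¹ ≠ 0 := by positivity
  have h₃ : 1 + q ≠ 0 := by positivity
  rw [div_div, div_sub_div _ _ h₃ (mul_ne_zero h₃ h₁), div_eq_div_iff h₂ (by positivity)]
  field_simp
  ring

theorem h_monotone {q α : ℝ} (hq0 : 0 < q) (hq1 : q < 1) (hα : 0 < α) : Monotone (h q α) := by
  intro x y hxy
  have hq : 0 < 1 - q := by linarith
  rw [h_eq_sub_div hq0 hq1, h_eq_sub_div hq0 hq1]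
  gcongr

theorem tendsto_h_atTop {q α : ℝ} (hq0 : 0 < q) (hq1 : q < 1) (hα : 0 < α) :
    Tendsto (h q α) atTop (𝓝 (1 / (1 + q))) := by
  rw [funext (h_eq_sub_div hq0 hq1 α)]
  have hexp : Tendsto (fun x => Real.exp (2 * α * x)) atTop atTop :=
    Real.tendsto_exp_atTop.comp (tendsto_id.const_mul_atTop (by positivity))
  have hden := tendsto_atTop_add_const_right atTop (1 - q)
    (hexp.const_mul_atTop (by positivity : 0 < 1 + q))
  simpa using (hden.const_div_atTop ((1 + q ^ 2) / (1 + q))).const_sub (1 / (1 + q))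

theorem tendsto_h_atBot {q α : ℝ} (hq0 : 0 < q) (hq1 : q < 1) (hα : 0 < α) :
    Tendsto (h q α) atBot (𝓝 (-q / (1 - q))) := by
  rw [funext (h_eq_sub_div hq0 hq1 α)]
  have hq : 1 - q ≠ 0 := by linarith
  have hexp : Tendsto (fun x => Real.exp (2 * α * x)) atBot (𝓝 0) :=
    Real.tendsto_exp_atBot.comp (tendsto_id.const_mul_atBot (by positivity))
  have hden := (hexp.const_mul (1 + q)).add_const (1 - q)
  have hval : -q / (1 - q) =
      1 / (1 + q) - (1 + q ^ 2) / (1 + q) / ((1 + q) * 0 + (1 - q)) := by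
    rw [mul_zero, zero_add]
    field_simp
    ring
  rw [hval]
  exact (tendsto_const_nhds.div hden (by simpa using hq)).const_sub _

theorem hasSum_h_sub {q α : ℝ} (hq0 : 0 < q) (hq1 : q < 1) (hα : 0 < α) (x : ℝ) :
    HasSum (fun k : ℤ => h q α (x - k + 1) - h q α (x - k)) (1 / (1 + q) - -q / (1 - q)) := by
  have hmono : Monotone fun k : ℤ => h q α (x + k) := fun m n hmn =>
    h_monotone hq0 hq1 hα (by gcongr)
  have hsum := hmono.hasSum_int_sub_of_tendsto
    ((tendsto_h_atTop hq0 hq1 hα).comp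
      (tendsto_atTop_add_const_left _ x tendsto_intCast_atTop_atTop))
    ((tendsto_h_atBot hq0 hq1 hα).comp
      (tendsto_atBot_add_const_left _ x (tendsto_intCast_atBot_iff.2 tendsto_id)))
  rw [← (Equiv.neg ℤ).hasSum_iff] at hsum
  convert hsum using 2 with k
  simp [sub_eq_add_neg, add_assoc]

theorem psi_partition_of_unity (q α : ℝ) (hq0 : 0 < q) (hq1 : q < 1) (hα : 0 < α) :
    ∀ x : ℝ, Summable (fun k : ℤ => ψ q α (x - k)) ∧ ∑' k : ℤ, ψ q α (x - k) = 1 := by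
  intro x
  suffices HasSum (fun k : ℤ => ψ q α (x - k)) 1 from ⟨this.summable, this.tsum_eq⟩
  have hq : 1 - q ≠ 0 := by linarith
  have hsum := ((hasSum_h_sub hq0 hq1 hα x).add (hasSum_h_sub hq0 hq1 hα (x - 1))).mul_left
    ((1 - q ^ 2) / (2 * (1 + q ^ 2)))
  have hval : (1 - q ^ 2) / (2 * (1 + q ^ 2)) *
      (1 / (1 + q) - -q / (1 - q) + (1 / (1 + q) - -q / (1 - q))) = 1 := by
    have hsq : 1 - q ^ 2 = (1 - q) * (1 + q) := by ring
    rw [hsq]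
    field_simp
    ring
  rw [hval] at hsum
  have hterm (k : ℤ) : ψ q α (x - k) = (1 - q ^ 2) / (2 * (1 + q ^ 2)) *
      (h q α (x - k + 1) - h q α (x - k) + (h q α (x - 1 - k + 1) - h q α (x - 1 - k))) := by
    rw [ψ, show x - 1 - k + 1 = x - k by ring, show x - 1 - k = x - k - 1 by ring]
    ring
  simpa only [hterm] using hsum
end

section
/- Let q and α be real numbers with 0 < q < 1 and α > 0. Then there exists a constant C > 0 such that 0 < ψ_{q,α}(x) ≤ C·e^{−2α|x|} for every x ∈ ℝ; that is, the density function decays exponentially at rate 2α in both directions. -/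
/-- The activation function as a Möbius transformation of `exp (2 * α * x)`. -/
theorem h_eq_div (q α x : ℝ) :
    h q α x = (Real.exp (2 * α * x) - q) / ((1 + q) * Real.exp (2 * α * x) + (1 - q)) := by
  have hsq : Real.exp (2 * α * x) = Real.exp (α * x) * Real.exp (α * x) := by
    rw [← Real.exp_add]; ring_nf
  have hinv : Real.exp (α * x) * Real.exp (-(α * x)) = 1 := by
    rw [← Real.exp_add]; simp
  rw [h, hsq, ← mul_div_mul_left _ _ (Real.exp_pos (α * x)).ne']
  congr 1
  · linear_combination (-q) * hinv
  · linear_combination (1 - q) * hinv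

theorem psi_eq_div (q α x : ℝ) (hq0 : 0 < q) (hq1 : q < 1) :
    ψ q α x = (1 - q ^ 2) / 2 * (Real.exp (2 * α) - (Real.exp (2 * α))⁻¹) *
      (Real.exp (2 * α * x) /
        (((1 + q) * (Real.exp (2 * α * x) * Real.exp (2 * α)) + (1 - q)) *
          ((1 + q) * (Real.exp (2 * α * x) * (Real.exp (2 * α))⁻¹) + (1 - q)))) := by
  have hplus : Real.exp (2 * α * (x + 1)) = Real.exp (2 * α * x) * Real.exp (2 * α) := by
    rw [← Real.exp_add]; ring_nf
  have hminus : Real.exp (2 * α * (x - 1)) = Real.exp (2 * α * x) * (Real.exp (2 * α))⁻¹ := by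
    rw [← Real.exp_neg, ← Real.exp_add]; ring_nf
  rw [ψ, h_eq_div, h_eq_div, hplus, hminus]
  have hq : 0 < 1 - q := sub_pos.2 hq1
  have hu := Real.exp_pos (2 * α * x)
  have hk := Real.exp_pos (2 * α)
  generalize Real.exp (2 * α * x) = u at *
  have hk' := inv_pos.2 hk
  generalize (Real.exp (2 * α))⁻¹ = m at *
  generalize Real.exp (2 * α) = k at *
  have hA : (1 + q) * (u * k) + (1 - q) ≠ 0 := by positivity
  have hB : (1 + q) * (u * m) + (1 - q) ≠ 0 := by positivity
  rw [div_sub_div _ _ hA hB]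
  have hq2 : 1 + q ^ 2 ≠ 0 := by positivity
  rw [div_mul_div_comm, mul_div_assoc', div_eq_div_iff (by positivity) (by positivity)]
  ring

theorem psi_exponential_decay (q α : ℝ) (hq0 : 0 < q) (hq1 : q < 1) (hα : 0 < α) :
    ∃ C : ℝ, 0 < C ∧ ∀ x : ℝ, 0 < ψ q α x ∧ ψ q α x ≤ C * Real.exp (-(2 * α * |x|)) := by
  have hq : 0 < 1 - q := sub_pos.2 hq1
  have hq2 : 0 < 1 - q ^ 2 := by nlinarith
  have hk1 : 1 < Real.exp (2 * α) := Real.one_lt_exp_iff.2 (by positivity)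
  have hk : 0 < Real.exp (2 * α) - (Real.exp (2 * α))⁻¹ :=
    sub_pos.2 ((inv_lt_one_of_one_lt₀ hk1).trans hk1)
  refine ⟨(1 - q ^ 2) / 2 * (Real.exp (2 * α) - (Real.exp (2 * α))⁻¹) * ((1 - q) ^ 2)⁻¹,
    by positivity, fun x => ?_⟩
  rw [psi_eq_div q α x hq0 hq1]
  refine ⟨by positivity, ?_⟩
  rw [mul_assoc _ _ (Real.exp (-(2 * α * |x|)))]
  refine mul_le_mul_of_nonneg_left ?_ (by positivity)
  have hu := Real.exp_pos (2 * α * x)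
  have hkm : Real.exp (2 * α) * (Real.exp (2 * α))⁻¹ = 1 :=
    mul_inv_cancel₀ (Real.exp_pos _).ne'
  have hk0 := Real.exp_pos (2 * α)
  have hm0 := inv_pos.2 hk0
  have habs : Real.exp (-(2 * α * |x|)) = Real.exp (2 * α * x) ∨
      Real.exp (-(2 * α * |x|)) = (Real.exp (2 * α * x))⁻¹ := by
    rcases abs_choice x with hx | hx <;> rw [hx]
    · exact Or.inr (Real.exp_neg _)
    · left; ring_nf
  generalize Real.exp (-(2 * α * |x|)) = w at *
  generalize Real.exp (2 * α * x) = u at *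
  generalize (Real.exp (2 * α))⁻¹ = m at *
  generalize Real.exp (2 * α) = k at *
  have hexpand : ((1 + q) * (u * k) + (1 - q)) * ((1 + q) * (u * m) + (1 - q)) =
      (1 + q) ^ 2 * u ^ 2 + (1 - q) ^ 2 + (1 + q) * (1 - q) * u * (k + m) := by
    linear_combination (1 + q) ^ 2 * u ^ 2 * hkm
  have hcross : 0 ≤ (1 + q) * (1 - q) * u * (k + m) := by positivity
  rcases habs with rfl | rfl
  · rw [inv_mul_eq_div]
    refine div_le_div_of_nonneg_left hu.le (by positivity) ?_
    rw [hexpand]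
    nlinarith [sq_nonneg ((1 + q) * w)]
  · rw [← mul_inv, ← one_div, div_le_div_iff₀ (by positivity) (by positivity), hexpand]
    have hcoef : 0 ≤ q * u ^ 2 := by positivity
    nlinarith [sq_nonneg (1 - q)]
end

section
/- Let q and α be real numbers with 0 < q < 1 and α > 0, and let m be a natural number. Then there exists a constant C > 0 such that for every x ∈ ℝ the family (|x − k|^m · ψ_{q,α}(x − k))_{k ∈ ℤ} is summable and Σ_{k ∈ ℤ} |x − k|^m · ψ_{q,α}(x − k) ≤ C (uniform boundedness of the m-th absolute moments of the lattice translates of the density function). -/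
theorem psi_eq {q : ℝ} (hq0 : 0 < q) (hq1 : q < 1) (α x : ℝ) :
    ψ q α x = (1 - q ^ 2) / 2 * (Real.exp (2 * α) - Real.exp (-(2 * α))) /
      (((1 + q) * Real.exp (α * (x + 1)) + (1 - q) * Real.exp (-(α * (x + 1)))) *
        ((1 + q) * Real.exp (α * (x - 1)) + (1 - q) * Real.exp (-(α * (x - 1))))) := by
  have hq : 0 < 1 - q := sub_pos.2 hq1
  have hD (y : ℝ) : (1 + q) * Real.exp (α * y) + (1 - q) * Real.exp (-(α * y)) ≠ 0 := by
    positivity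
  have h1 : Real.exp (α * (x + 1)) * Real.exp (-(α * (x - 1))) = Real.exp (2 * α) := by
    rw [← Real.exp_add]; ring_nf
  have h2 : Real.exp (-(α * (x + 1))) * Real.exp (α * (x - 1)) = Real.exp (-(2 * α)) := by
    rw [← Real.exp_add]; ring_nf
  have h3 : (1 + q ^ 2 : ℝ) ≠ 0 := by positivity
  rw [ψ, h, h, div_sub_div _ _ (hD _) (hD _), ← h1, ← h2]
  field_simp [hD]
  ring

theorem psi_nonneg {q α : ℝ} (hq0 : 0 < q) (hq1 : q < 1) (hα : 0 < α) (x : ℝ) :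
    0 ≤ ψ q α x := by
  have hq : 0 < 1 - q := sub_pos.2 hq1
  have hq2 : 0 ≤ 1 - q ^ 2 := by nlinarith
  have he : 0 ≤ Real.exp (2 * α) - Real.exp (-(2 * α)) :=
    sub_nonneg.2 (Real.exp_le_exp.2 (by linarith))
  rw [psi_eq hq0 hq1]
  positivity

theorem exists_psi_le_exp {q α : ℝ} (hq0 : 0 < q) (hq1 : q < 1) (hα : 0 < α) :
    ∃ K : ℝ, 0 ≤ K ∧ ∀ x : ℝ, ψ q α x ≤ K * Real.exp (-(2 * α * |x|)) := by
  have hq : 0 < 1 - q := sub_pos.2 hq1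
  have hq2 : 0 ≤ 1 - q ^ 2 := by nlinarith
  have he : 0 ≤ Real.exp (2 * α) - Real.exp (-(2 * α)) :=
    sub_nonneg.2 (Real.exp_le_exp.2 (by linarith))
  refine ⟨(1 - q ^ 2) / 2 * (Real.exp (2 * α) - Real.exp (-(2 * α))) / (1 - q) ^ 2,
    by positivity, fun x => ?_⟩
  have key : (1 - q) ^ 2 * Real.exp (2 * α * |x|) ≤
      ((1 + q) * Real.exp (α * (x + 1)) + (1 - q) * Real.exp (-(α * (x + 1)))) *
        ((1 + q) * Real.exp (α * (x - 1)) + (1 - q) * Real.exp (-(α * (x - 1)))) := by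
    rcases abs_cases x with ⟨hx, -⟩ | ⟨hx, -⟩ <;> rw [hx]
    · have : Real.exp (2 * α * x) = Real.exp (α * (x + 1)) * Real.exp (α * (x - 1)) := by
        rw [← Real.exp_add]; ring_nf
      rw [this]
      calc _ = ((1 - q) * Real.exp (α * (x + 1))) * ((1 - q) * Real.exp (α * (x - 1))) := by ring
        _ ≤ ((1 + q) * Real.exp (α * (x + 1))) * ((1 + q) * Real.exp (α * (x - 1))) := by
          gcongr <;> linarith
        _ ≤ _ := by
          gcongr <;> exact le_add_of_nonneg_right (by positivity)
    · have : Real.exp (2 * α * -x) =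
          Real.exp (-(α * (x + 1))) * Real.exp (-(α * (x - 1))) := by
        rw [← Real.exp_add]; ring_nf
      rw [this]
      calc _ = ((1 - q) * Real.exp (-(α * (x + 1)))) * ((1 - q) * Real.exp (-(α * (x - 1)))) := by
            ring
        _ ≤ _ := by
          gcongr <;> exact le_add_of_nonneg_left (by positivity)
  rw [psi_eq hq0 hq1, Real.exp_neg (2 * α * |x|), ← div_eq_mul_inv, div_div]
  gcongr

theorem summable_exp_neg_mul_abs_int {α : ℝ} (hα : 0 < α) :
    Summable (fun j : ℤ => Real.exp (-(α * |(j : ℝ)|))) := by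
  have hs : Summable (fun n : ℕ => Real.exp (-(α * n))) := by
    refine (Real.summable_exp_nat_mul_iff.2 (neg_lt_zero.2 hα)).congr fun n => ?_
    ring_nf
  exact Summable.of_nat_of_neg (by simpa using hs) (by simpa using hs)

theorem psi_moments_uniformly_bounded (q α : ℝ) (hq0 : 0 < q) (hq1 : q < 1) (hα : 0 < α)
    (m : ℕ) :
    ∃ C : ℝ, 0 < C ∧ ∀ x : ℝ,
      Summable (fun k : ℤ => |x - k| ^ m * ψ q α (x - k)) ∧
      ∑' k : ℤ, |x - k| ^ m * ψ q α (x - k) ≤ C := by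
  obtain ⟨K, hK, hψ⟩ := exists_psi_le_exp hq0 hq1 hα
  set A : ℝ := m.factorial / α ^ m * K * Real.exp α with hA
  have hpow (y : ℝ) : |y| ^ m ≤ m.factorial / α ^ m * Real.exp (α * |y|) := by
    have := Real.pow_div_factorial_le_exp (α * |y|) (by positivity) m
    rw [mul_pow, div_le_iff₀ (by positivity)] at this
    rw [div_mul_eq_mul_div, le_div_iff₀ (by positivity)]
    linarith
  have hterm (x : ℝ) (k : ℤ) : |x - k| ^ m * ψ q α (x - k) ≤
      A * Real.exp (-(α * |((⌊x⌋ - k : ℤ) : ℝ)|)) := by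
    have habs : |((⌊x⌋ - k : ℤ) : ℝ)| ≤ |x - k| + 1 := by
      have h1 : ((⌊x⌋ - k : ℤ) : ℝ) = (x - k) - Int.fract x := by
        push_cast [Int.fract]; ring
      rw [h1]
      refine (abs_sub _ _).trans ?_
      rw [abs_of_nonneg (Int.fract_nonneg x)]
      linarith [Int.fract_lt_one x]
    calc |x - k| ^ m * ψ q α (x - k)
        ≤ (m.factorial / α ^ m * Real.exp (α * |x - k|)) *
            (K * Real.exp (-(2 * α * |x - k|))) :=
          mul_le_mul (hpow _) (hψ _) (psi_nonneg hq0 hq1 hα _) (by positivity)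
      _ = m.factorial / α ^ m * K * Real.exp (-(α * |x - k|)) := by
          rw [mul_mul_mul_comm, ← Real.exp_add]; ring_nf
      _ ≤ m.factorial / α ^ m * K * Real.exp (α + -(α * |((⌊x⌋ - k : ℤ) : ℝ)|)) := by
          gcongr
          nlinarith
      _ = _ := by rw [Real.exp_add, hA]; ring
  have hsum : Summable (fun j : ℤ => A * Real.exp (-(α * |(j : ℝ)|))) :=
    (summable_exp_neg_mul_abs_int hα).mul_left A
  have hA0 : 0 ≤ A := by positivity
  refine ⟨∑' j : ℤ, A * Real.exp (-(α * |(j : ℝ)|)) + 1,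
    add_pos_of_nonneg_of_pos (tsum_nonneg fun j => by positivity) one_pos, fun x => ?_⟩
  have hshift := (Equiv.subLeft ⌊x⌋).summable_iff.2 hsum
  have hS : Summable (fun k : ℤ => |x - k| ^ m * ψ q α (x - k)) :=
    hshift.of_nonneg_of_le (fun k => mul_nonneg (by positivity) (psi_nonneg hq0 hq1 hα _))
      (hterm x)
  refine ⟨hS, (hS.tsum_le_tsum (hterm x) hshift).trans ?_⟩
  have := (Equiv.subLeft ⌊x⌋).tsum_eq (fun j : ℤ => A * Real.exp (-(α * |(j : ℝ)|)))
  simp only [Equiv.subLeft_apply] at this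
  linarith
end

section
/- Let q and α be real numbers with 0 < q < 1 and α > 0, let n be a positive integer, and let f : ℝ → ℝ be a function of at most polynomial growth, i.e., there exist constants B > 0 and d ∈ ℕ with |f(t)| ≤ B·(1 + |t|)^d for all t ∈ ℝ. Then for every x ∈ ℝ the family (f(k/n) · ψ_{q,α}(n x − k))_{k ∈ ℤ} is summable, so the quasi-interpolation neural network operator A_n(f; x) = Σ_{k ∈ ℤ} f(k/n) · ψ_{q,α}(n x − k) is well defined at every point. -/
/-- The denominator of `h` grows at least exponentially in both directions. -/
theorem le_h_denominator {q α : ℝ} (hq0 : 0 < q) (hq1 : q < 1) (y : ℝ) :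
    (1 - q) * Real.exp (α * |y|) ≤
      (1 + q) * Real.exp (α * y) + (1 - q) * Real.exp (-(α * y)) := by
  have h1 := Real.exp_pos (α * y)
  have h2 := Real.exp_pos (-(α * y))
  rcases abs_cases y with ⟨hy, -⟩ | ⟨hy, -⟩
  · rw [hy]
    nlinarith
  · rw [hy, mul_neg]
    nlinarith

theorem h_add_one_sub_h_sub_one {q α : ℝ} (hq0 : 0 < q) (hq1 : q < 1) (x : ℝ) :
    h q α (x + 1) - h q α (x - 1) =
      (1 + q ^ 2) * (Real.exp (2 * α) - Real.exp (-(2 * α))) /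
        (((1 + q) * Real.exp (α * (x + 1)) + (1 - q) * Real.exp (-(α * (x + 1)))) *
          ((1 + q) * Real.exp (α * (x - 1)) + (1 - q) * Real.exp (-(α * (x - 1))))) := by
  have hD : ∀ y : ℝ, (1 + q) * Real.exp (α * y) + (1 - q) * Real.exp (-(α * y)) ≠ 0 := fun y =>
    ((mul_pos (sub_pos.2 hq1) (Real.exp_pos _)).trans_le (le_h_denominator hq0 hq1 y)).ne'
  have e1 : Real.exp (2 * α) = Real.exp (α * (x + 1)) * Real.exp (-(α * (x - 1))) := by
    rw [← Real.exp_add]; ring_nf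
  have e2 : Real.exp (-(2 * α)) = Real.exp (α * (x - 1)) * Real.exp (-(α * (x + 1))) := by
    rw [← Real.exp_add]; ring_nf
  rw [h, h, div_sub_div _ _ (hD _) (hD _), e1, e2]
  congr 1
  ring

/-- The density `ψ` decays exponentially at rate `2 * α`. -/
theorem abs_ψ_le {q α : ℝ} (hq0 : 0 < q) (hq1 : q < 1) (hα : 0 < α) :
    ∃ C : ℝ, ∀ x : ℝ, |ψ q α x| ≤ C * Real.exp (-(2 * α * |x|)) := by
  have hq : 0 < 1 - q := sub_pos.2 hq1
  refine ⟨|(1 - q ^ 2) / (2 * (1 + q ^ 2))| *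
    (|(1 + q ^ 2) * (Real.exp (2 * α) - Real.exp (-(2 * α)))| / (1 - q) ^ 2), fun x => ?_⟩
  have hx : 2 * |x| ≤ |x + 1| + |x - 1| := by
    have := abs_add_le (x + 1) (x - 1)
    rwa [show x + 1 + (x - 1) = 2 * x by ring, abs_mul, abs_two] at this
  have hD : (1 - q) ^ 2 * Real.exp (2 * α * |x|) ≤
      ((1 + q) * Real.exp (α * (x + 1)) + (1 - q) * Real.exp (-(α * (x + 1)))) *
        ((1 + q) * Real.exp (α * (x - 1)) + (1 - q) * Real.exp (-(α * (x - 1)))) := by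
    calc (1 - q) ^ 2 * Real.exp (2 * α * |x|)
        ≤ (1 - q) ^ 2 * Real.exp (α * |x + 1| + α * |x - 1|) := by
          gcongr
          nlinarith
      _ = ((1 - q) * Real.exp (α * |x + 1|)) * ((1 - q) * Real.exp (α * |x - 1|)) := by
          rw [Real.exp_add]; ring
      _ ≤ _ := mul_le_mul (le_h_denominator hq0 hq1 _) (le_h_denominator hq0 hq1 _)
          (by positivity) (by positivity)
  have hpos : 0 < (1 - q) ^ 2 * Real.exp (2 * α * |x|) := by positivity
  rw [ψ, h_add_one_sub_h_sub_one hq0 hq1, abs_mul, mul_assoc,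
    abs_div (_ * (Real.exp _ - _)), abs_of_pos (hpos.trans_le hD), Real.exp_neg (_ * |x|), ← div_eq_mul_inv, div_div]
  gcongr

theorem summable_int_one_add_abs_pow_mul_exp_neg (d : ℕ) {r : ℝ} (hr : 0 < r) :
    Summable (fun k : ℤ => (1 + |(k : ℝ)|) ^ d * Real.exp (-(r * |(k : ℝ)|))) := by
  have hnat : Summable (fun k : ℕ => (1 + (k : ℝ)) ^ d * Real.exp (-(r * k))) := by
    refine (((summable_nat_add_iff 1).2
      (Real.summable_pow_mul_exp_neg_nat_mul d hr)).mul_right (Real.exp r)).congr fun k => ?_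
    rw [mul_assoc, ← Real.exp_add]
    push_cast
    ring_nf
  exact Summable.of_nat_of_neg (by simpa using hnat) (by simpa using hnat)

theorem quasi_interpolation_well_defined (q α : ℝ) (hq0 : 0 < q) (hq1 : q < 1) (hα : 0 < α)
    (n : ℕ) (hn : 0 < n) (f : ℝ → ℝ) (B : ℝ) (hB : 0 < B) (d : ℕ)
    (hf : ∀ t : ℝ, |f t| ≤ B * (1 + |t|) ^ d) :
    ∀ x : ℝ, Summable (fun k : ℤ => f (k / n) * ψ q α (n * x - k)) := by
  intro x
  obtain ⟨C, hC⟩ := abs_ψ_le hq0 hq1 hα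
  have hC0 : 0 ≤ C :=
    nonneg_of_mul_nonneg_left ((abs_nonneg _).trans (hC 0)) (Real.exp_pos _)
  refine Summable.of_norm_bounded
    ((summable_int_one_add_abs_pow_mul_exp_neg d (by positivity : 0 < 2 * α)).mul_left
      (B * C * Real.exp (2 * α * |n * x|))) fun k => ?_
  have hn1 : (1 : ℝ) ≤ n := by exact_mod_cast hn
  have hk : |(k : ℝ) / n| ≤ |(k : ℝ)| := by
    rw [abs_div, Nat.abs_cast]
    exact div_le_self (abs_nonneg _) hn1
  have hdist : |(k : ℝ)| - |n * x| ≤ |n * x - k| := by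
    rw [abs_sub_comm]
    exact abs_sub_abs_le_abs_sub _ _
  rw [Real.norm_eq_abs, abs_mul]
  calc |f (k / n)| * |ψ q α (n * x - k)|
      ≤ (B * (1 + |(k : ℝ) / n|) ^ d) * (C * Real.exp (-(2 * α * |n * x - k|))) :=
        mul_le_mul (hf _) (hC _) (abs_nonneg _) (by positivity)
    _ ≤ (B * (1 + |(k : ℝ)|) ^ d) *
          (C * Real.exp (2 * α * |n * x| + -(2 * α * |(k : ℝ)|))) := by
        gcongr
        nlinarith
    _ = _ := by
        rw [Real.exp_add]
        ring
end
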